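/- (Quantification of the non-deterministic EOB for a stationary AR(p)-structured Gaussian process, KL form) Let 1 ≤ p ≤ T, let σ_z > 0 and σ_ε > 0, let μ ∈ ℝ^T, and let Σ be a real symmetric positive definite T×T matrix with Σ_{tt} = σ_z² for all 0 ≤ t ≤ T−1 and s_t(Σ) = σ_ε² for all p ≤ t ≤ T−1. With p(x) the T-dimensional Gaussian density with mean μ and covariance Σ, and q(x) = ∏_{i=0}^{T−1} (2π σ_z²)^{−1/2} exp(−(x_i−μ_i)²/(2σ_z²)) the product of its marginals, one has ∫_{ℝ^T} p(x) · log( p(x)/q(x) ) dx = ((T−p)/2) · log(σ_z²/σ_ε²) − ½ log det R(Σ^{(p)}). -/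

import Mathlib

open Matrix MeasureTheory

/-- The correlation matrix: `R(Σ)_{ij} = Σ_{ij} / √(Σ_{ii} Σ_{jj})`. -/
noncomputable def corrMat {T : ℕ} (S : Matrix (Fin T) (Fin T) ℝ) :
    Matrix (Fin T) (Fin T) ℝ :=
  fun i j => S i j / Real.sqrt (S i i * S j j)

/-- The `k×k` leading principal submatrix of a `T×T` matrix (0-based indices). -/
def lead {T : ℕ} (S : Matrix (Fin T) (Fin T) ℝ) (k : ℕ) (hk : k ≤ T) :
    Matrix (Fin k) (Fin k) ℝ :=
  S.submatrix (Fin.castLE hk) (Fin.castLE hk)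

/-- The innovation variances: `s_0(Σ) = Σ_{00}` and, for `t ≥ 1`,
`s_t(Σ) = Σ_{tt} − b_tᵀ (Σ^{(t)})⁻¹ b_t` with `b_t = (Σ_{it})_{i<t}`. -/
noncomputable def innov {T : ℕ} (S : Matrix (Fin T) (Fin T) ℝ) (t : Fin T) : ℝ :=
  S t t -
    (fun i : Fin t.val => S (Fin.castLE t.isLt.le i) t) ⬝ᵥ
      ((lead S t.val t.isLt.le)⁻¹ *ᵥ fun i : Fin t.val => S (Fin.castLE t.isLt.le i) t)

/-- The multivariate Gaussian density on `ℝ^T` with mean `μ` and covariance `Σ`. -/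
noncomputable def gaussPDF {T : ℕ} (μ : Fin T → ℝ) (S : Matrix (Fin T) (Fin T) ℝ)
    (x : Fin T → ℝ) : ℝ :=
  ((2 * Real.pi) ^ T * S.det) ^ (-(1 / 2) : ℝ) *
    Real.exp (-(1 / 2) * ((x - μ) ⬝ᵥ (S⁻¹ *ᵥ (x - μ))))

open ProbabilityTheory in
lemma g1_int (n : ℕ) : Integrable (fun y : ℝ => gaussianPDFReal 0 1 y * y ^ n) := by
  have h := (integrable_rpow_mul_exp_neg_mul_sq (b := 1/2) (by norm_num) (s := (n:ℝ))
    (by have : (0:ℝ) ≤ n := n.cast_nonneg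
        linarith)).const_mul ((√(2 * Real.pi * 1))⁻¹)
  refine h.congr (Filter.Eventually.of_forall fun y => ?_)
  simp only [gaussianPDFReal, Real.rpow_natCast, NNReal.coe_one, sub_zero]
  rw [show -(1/2) * y^2 = -y^2/(2*1) by ring]
  ring

open ProbabilityTheory in
lemma g1_one : ∫ y : ℝ, gaussianPDFReal 0 1 y * y = 0 := by
  have := integral_id_gaussianReal (μ := 0) (v := 1)
  rw [integral_gaussianReal_eq_integral_smul (by norm_num)] at this
  simpa using this

open ProbabilityTheory in
lemma g1_two : ∫ y : ℝ, gaussianPDFReal 0 1 y * y ^ 2 = 1 := by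
  have := variance_fun_id_gaussianReal (μ := 0) (v := 1)
  rw [variance_eq_integral (by fun_prop), integral_id_gaussianReal,
    integral_gaussianReal_eq_integral_smul (by norm_num)] at this
  simpa using this

/-- standard Gaussian density -/
noncomputable def stdG {T : ℕ} (y : Fin T → ℝ) : ℝ :=
  ∏ i, ProbabilityTheory.gaussianPDFReal 0 1 (y i)

open ProbabilityTheory in
lemma stdG_moment {T : ℕ} (j k : Fin T) :
    Integrable (fun y : Fin T → ℝ => stdG y * (y j * y k)) ∧
    ∫ y : Fin T → ℝ, stdG y * (y j * y k) = if j = k then 1 else 0 := by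
  set f : Fin T → ℝ → ℝ := fun i y => gaussianPDFReal 0 1 y *
    ((if i = j then y else 1) * (if i = k then y else 1)) with hf
  have e : (fun y : Fin T → ℝ => stdG y * (y j * y k)) = fun y => ∏ i, f i (y i) := by
    funext y
    simp only [hf, stdG, Finset.prod_mul_distrib, Finset.prod_ite_eq', Finset.mem_univ, if_true]
  have fi : ∀ i, Integrable (f i) := by
    intro i
    have h0 := g1_int 0
    have h1 := g1_int 1
    have h2 := g1_int 2
    simp only [pow_zero, pow_one, pow_two] at h0 h1 h2
    by_cases a : i = j <;> by_cases b : i = k <;> simp only [hf, a, b, if_true, if_false, mul_one, one_mul] <;> simp_all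
  rw [e]
  refine ⟨Integrable.fintype_prod fi, ?_⟩
  rw [integral_fintype_prod_volume_eq_prod f]
  split_ifs with h
  · subst h
    refine Finset.prod_eq_one fun i _ => ?_
    by_cases a : i = j
    · simpa [hf, a, ← pow_two] using g1_two
    · simpa [hf, a] using integral_gaussianPDFReal_eq_one 0 (v := 1) (by norm_num)
  · refine Finset.prod_eq_zero (Finset.mem_univ j) ?_
    simpa [hf, h] using g1_one

open ProbabilityTheory in
lemma stdG_one {T : ℕ} : Integrable (fun y : Fin T → ℝ => stdG y) ∧
    ∫ y : Fin T → ℝ, stdG y = 1 := by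
  refine ⟨Integrable.fintype_prod (f := fun _ => gaussianPDFReal 0 1)
    fun _ => integrable_gaussianPDFReal 0 1, ?_⟩
  unfold stdG
  rw [integral_fintype_prod_volume_eq_prod (fun _ : Fin T => gaussianPDFReal 0 1)]
  exact Finset.prod_eq_one fun i _ => integral_gaussianPDFReal_eq_one 0 (v := 1) (by norm_num)

lemma stdG_quad {T : ℕ} (K : ℝ) (M : Matrix (Fin T) (Fin T) ℝ) :
    ∫ y : Fin T → ℝ, stdG y * (K + y ⬝ᵥ M *ᵥ y) = K + M.trace := by
  have e : (fun y : Fin T → ℝ => stdG y * (K + y ⬝ᵥ M *ᵥ y)) =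
      fun y => K * stdG y + ∑ i, ∑ j, M i j * (stdG y * (y i * y j)) := by
    funext y
    simp only [dotProduct, mulVec, mul_add, Finset.mul_sum]
    congr 1
    · ring
    · exact Finset.sum_congr rfl fun i _ => Finset.sum_congr rfl fun j _ => by ring
  have hi : ∀ i j, Integrable fun y : Fin T → ℝ => M i j * (stdG y * (y i * y j)) :=
    fun i j => (stdG_moment i j).1.const_mul _
  rw [e, integral_add (stdG_one.1.const_mul K)
    (integrable_finsetSum _ fun i _ => integrable_finsetSum _ fun j _ => hi i j),
    integral_const_mul, stdG_one.2, integral_finsetSum _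
      (fun i _ => integrable_finsetSum _ fun j _ => hi i j)]
  simp_rw [integral_finsetSum _ (fun j _ => hi _ j), integral_const_mul, (stdG_moment _ _).2]
  simp [Matrix.trace]

lemma lead_posDef {T : ℕ} {S : Matrix (Fin T) (Fin T) ℝ} (hS : S.PosDef) (k : ℕ) (hk : k ≤ T) :
    (lead S k hk).PosDef := hS.submatrix (Fin.castLE_injective hk)

lemma lead_det_succ {T : ℕ} {S : Matrix (Fin T) (Fin T) ℝ} (hS : S.PosDef) (t : ℕ) (ht : t < T) :
    (lead S (t+1) ht).det = (lead S t ht.le).det * innov S ⟨t, ht⟩ := by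
  have hsymm : ∀ i j, S i j = S j i := fun i j => by
    have := hS.1.apply j i
    simpa using this
  have hu : IsUnit (lead S t ht.le).det := (lead_posDef hS t ht.le).det_pos.ne'.isUnit
  letI : Invertible (lead S t ht.le) := Matrix.invertibleOfIsUnitDet _ hu
  rw [← det_submatrix_equiv_self (finSumFinEquiv : Fin t ⊕ Fin 1 ≃ Fin (t+1)),
    ← fromBlocks_toBlocks (submatrix _ _ _)]
  have e11 : ((lead S (t+1) ht).submatrix (finSumFinEquiv : Fin t ⊕ Fin 1 ≃ Fin (t+1))
      finSumFinEquiv).toBlocks₁₁ = lead S t ht.le := by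
    ext i j; rfl
  rw [e11, det_fromBlocks₁₁, det_fin_one, invOf_eq_nonsing_inv]
  congr 1
  rw [innov, Matrix.sub_apply]
  congr 1
  rw [Matrix.mul_assoc, Matrix.mul_apply]
  simp only [dotProduct, mulVec, Matrix.mul_apply]
  refine Finset.sum_congr rfl fun i _ => ?_
  congr 1
  exact hsymm _ _

lemma lead_det_pow {T p : ℕ} {S : Matrix (Fin T) (Fin T) ℝ} (hS : S.PosDef) (hpT : p ≤ T) (c : ℝ)
    (hinn : ∀ t : Fin T, p ≤ t.val → innov S t = c) (n : ℕ) (hn : p + n ≤ T) :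
    (lead S (p+n) hn).det = (lead S p hpT).det * c ^ n := by
  induction n with
  | zero => simp
  | succ n ih =>
    have := lead_det_succ hS (p+n) hn
    rw [ih (by omega), hinn ⟨p+n, hn⟩ (by simp)] at this
    rw [pow_succ, ← mul_assoc]
    exact this

lemma det_total {T p : ℕ} {S : Matrix (Fin T) (Fin T) ℝ} (hS : S.PosDef) (hpT : p ≤ T) (c : ℝ)
    (hinn : ∀ t : Fin T, p ≤ t.val → innov S t = c) :
    S.det = (lead S p hpT).det * c ^ (T - p) := by
  obtain ⟨n, rfl⟩ := Nat.exists_eq_add_of_le hpT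
  have := lead_det_pow hS hpT c hinn n le_rfl
  rw [Nat.add_sub_cancel_left, ← this]
  rfl

lemma corr_det {T : ℕ} (S : Matrix (Fin T) (Fin T) ℝ) (s : ℝ) (hs : 0 < s)
    (hd : ∀ t, S t t = s ^ 2) : (corrMat S).det = S.det / (s ^ 2) ^ T := by
  have : corrMat S = (s^2)⁻¹ • S := by
    ext i j
    simp only [corrMat, hd, Matrix.smul_apply, smul_eq_mul]
    rw [Real.sqrt_mul_self (by positivity)]
    field_simp
  rw [this, det_smul]
  simp
  field_simp

lemma exists_factor {T : ℕ} {S : Matrix (Fin T) (Fin T) ℝ} (hS : S.PosDef) :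
    ∃ A : Matrix (Fin T) (Fin T) ℝ, A.det ≠ 0 ∧ S = A * Aᵀ := by
  have h := hS.posSemidef
  open scoped MatrixOrder in
  obtain ⟨B, hB⟩ := CStarAlgebra.nonneg_iff_eq_mul_star_self.1 h.nonneg
  refine ⟨B, fun h0 => hS.det_pos.ne' ?_, by simpa [star_eq_conjTranspose] using hB⟩
  rw [hB, det_mul, h0, zero_mul]

lemma change_var {T : ℕ} (μ : Fin T → ℝ) (A : Matrix (Fin T) (Fin T) ℝ) (hA : A.det ≠ 0)
    (F : (Fin T → ℝ) → ℝ) :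
    ∫ x, F x = ∫ y, |A.det| * F (μ + A *ᵥ y) := by
  set L : (Fin T → ℝ) →L[ℝ] (Fin T → ℝ) := (Matrix.toLin' A).toContinuousLinearMap
  have hU : IsUnit A := (Matrix.isUnit_iff_isUnit_det A).2 hA.isUnit
  have hinj : Function.Injective fun y => μ + A *ᵥ y := fun a b h =>
    Matrix.mulVec_injective_of_isUnit hU (add_left_cancel h)
  have hsurj : Function.Surjective fun y => μ + A *ᵥ y := fun b => by
    refine ⟨A⁻¹ *ᵥ (b - μ), ?_⟩
    simp [Matrix.mulVec_mulVec, Matrix.mul_nonsing_inv _ hA.isUnit]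
  have := integral_image_eq_integral_abs_det_fderiv_smul (μ := volume) (s := Set.univ)
    (f := fun y => μ + A *ᵥ y) (f' := fun _ => L) MeasurableSet.univ
    (fun x _ => (L.hasFDerivAt.const_add μ).hasFDerivWithinAt) hinj.injOn F
  rw [Set.image_univ, hsurj.range_eq] at this
  simpa [L, ContinuousLinearMap.det] using this

lemma stdG_eq {T : ℕ} (μ : Fin T → ℝ) (S A : Matrix (Fin T) (Fin T) ℝ) (hA : A.det ≠ 0)
    (hS : S = A * Aᵀ) (y : Fin T → ℝ) :
    (A *ᵥ y) ⬝ᵥ (S⁻¹ *ᵥ (A *ᵥ y)) = y ⬝ᵥ y ∧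
    |A.det| * gaussPDF μ S (μ + A *ᵥ y) = stdG y := by
  have hq : (A *ᵥ y) ⬝ᵥ (S⁻¹ *ᵥ (A *ᵥ y)) = y ⬝ᵥ y := by
    rw [hS, Matrix.mul_inv_rev, Matrix.mulVec_mulVec, Matrix.mul_assoc,
      Matrix.nonsing_inv_mul _ hA.isUnit, Matrix.mul_one, dotProduct_mulVec,
      ← Matrix.vecMul_transpose, Matrix.vecMul_vecMul,
      Matrix.mul_nonsing_inv _ (by simpa using hA), Matrix.vecMul_one]
  refine ⟨hq, ?_⟩
  rw [gaussPDF, add_sub_cancel_left, hq]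
  have hd : S.det = |A.det| ^ 2 := by rw [hS, det_mul, det_transpose, sq_abs, sq]
  have ha : 0 < |A.det| := abs_pos.2 hA
  have hpi := Real.pi_pos
  simp only [stdG, ProbabilityTheory.gaussianPDFReal, Finset.prod_mul_distrib,
    Finset.prod_const, ← Real.exp_sum, Finset.card_univ, Fintype.card_fin]
  rw [hd, ← mul_assoc]
  congr 1
  · rw [Real.rpow_neg (by positivity), ← Real.sqrt_eq_rpow, Real.sqrt_mul (by positivity),
      Real.sqrt_sq ha.le, mul_inv, NNReal.coe_one, mul_one]
    have : √((2*Real.pi)^T) = √(2*Real.pi)^T := by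
      rw [Real.sqrt_eq_iff_eq_sq (by positivity) (by positivity), ← pow_mul, mul_comm T 2, pow_mul,
        Real.sq_sqrt (by positivity)]
    rw [this, inv_pow]
    field_simp
  · congr 1
    simp only [dotProduct, Finset.mul_sum]
    refine Finset.sum_congr rfl fun i _ => ?_
    simp
    ring

/-- Quantification of the non-deterministic EOB for a stationary AR(p)-structured Gaussian
process (KL form): the KL divergence between the joint Gaussian and the product of its
marginals equals `((T−p)/2) log(σ_z²/σ_ε²) − ½ log det R(Σ^{(p)})`. -/
theorem EOB_AR_KL_form {T p : ℕ} (hp : 1 ≤ p) (hpT : p ≤ T)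
    (σz σε : ℝ) (hz : 0 < σz) (hε : 0 < σε)
    (μ : Fin T → ℝ) (S : Matrix (Fin T) (Fin T) ℝ) (hS : S.PosDef)
    (hdiag : ∀ t : Fin T, S t t = σz ^ 2)
    (hinn : ∀ t : Fin T, p ≤ t.val → innov S t = σε ^ 2) :
    (∫ x : Fin T → ℝ,
        gaussPDF μ S x *
          Real.log (gaussPDF μ S x /
            ∏ i, (2 * Real.pi * σz ^ 2) ^ (-(1 / 2) : ℝ) *
              Real.exp (-(x i - μ i) ^ 2 / (2 * σz ^ 2))))
      = ((T : ℝ) - p) / 2 * Real.log (σz ^ 2 / σε ^ 2)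
        - 1 / 2 * Real.log (corrMat (lead S p hpT)).det := by
  obtain ⟨A, hA, hSA⟩ := exists_factor hS
  have hpi := Real.pi_pos
  have hdet := hS.det_pos
  rw [change_var μ A hA]
  set K : ℝ := (T:ℝ) / 2 * Real.log (σz ^ 2) - 1 / 2 * Real.log S.det with hK
  set M : Matrix (Fin T) (Fin T) ℝ := (1 / (2 * σz ^ 2)) • (Aᵀ * A) - (1 / 2 : ℝ) • 1 with hM
  have e : ∀ y : Fin T → ℝ, |A.det| * (gaussPDF μ S (μ + A *ᵥ y) *
          Real.log (gaussPDF μ S (μ + A *ᵥ y) /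
            ∏ i, (2 * Real.pi * σz ^ 2) ^ (-(1 / 2) : ℝ) *
              Real.exp (-((μ + A *ᵥ y) i - μ i) ^ 2 / (2 * σz ^ 2)))) =
      stdG y * (K + y ⬝ᵥ M *ᵥ y) := by
    intro y
    obtain ⟨hq, hG⟩ := stdG_eq μ S A hA hSA y
    rw [← mul_assoc, hG]
    congr 1
    have hn : (A *ᵥ y) ⬝ᵥ (A *ᵥ y) = y ⬝ᵥ ((Aᵀ * A) *ᵥ y) := by
      rw [← Matrix.mulVec_mulVec, dotProduct_mulVec y, Matrix.vecMul_transpose]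
    rw [gaussPDF, add_sub_cancel_left, hq, Real.log_div (by positivity) (by positivity),
      Real.log_mul (by positivity) (by positivity), Real.log_exp,
      Real.log_rpow (by positivity), Real.log_mul (by positivity) (by positivity),
      Real.log_pow, Real.log_prod (fun i _ => by positivity)]
    have h2 : ∀ i, Real.log ((2 * Real.pi * σz ^ 2) ^ (-(1 / 2) : ℝ) *
              Real.exp (-((μ + A *ᵥ y) i - μ i) ^ 2 / (2 * σz ^ 2))) =
        -(1/2) * (Real.log (2 * Real.pi) + Real.log (σz ^ 2))
          - 1 / (2 * σz ^ 2) * ((A *ᵥ y) i * (A *ᵥ y) i) := by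
      intro i
      rw [Real.log_mul (by positivity) (by positivity), Real.log_exp,
        Real.log_rpow (by positivity), Real.log_mul (by positivity) (by positivity),
        Pi.add_apply]
      ring
    simp only [h2, Finset.sum_sub_distrib, ← Finset.mul_sum, Finset.sum_const, Finset.card_univ,
      Fintype.card_fin, nsmul_eq_mul]
    change _ - (_ - _ * ((A *ᵥ y) ⬝ᵥ (A *ᵥ y))) = _
    rw [hn, hM, hK, Matrix.sub_mulVec, dotProduct_sub, Matrix.smul_mulVec, Matrix.smul_mulVec,
      dotProduct_smul, dotProduct_smul, Matrix.one_mulVec, smul_eq_mul, smul_eq_mul]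
    ring
  simp_rw [e]
  have htr : M.trace = 0 := by
    have : (Aᵀ * A).trace = T * σz ^ 2 := by
      rw [Matrix.trace_mul_comm, ← hSA]
      simp [Matrix.trace, hdiag]
    rw [hM, Matrix.trace_sub, Matrix.trace_smul, Matrix.trace_smul, this, Matrix.trace_one]
    simp
    field_simp
    ring
  have hl := (lead_posDef hS p hpT).det_pos
  rw [stdG_quad, htr, hK, corr_det (lead S p hpT) σz hz (fun t => hdiag _),
    det_total hS hpT _ hinn, Real.log_mul hl.ne' (by positivity), Real.log_pow (σε ^ 2) (T - p),
    Real.log_div hl.ne' (by positivity), Real.log_pow (σz ^ 2) p, Real.log_div (by positivity) (by positivity),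
    Nat.cast_sub hpT]
  ring
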